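/- Let G be a finite simple graph. If C and C' are distinct Clar covers of G, then V(C) ≠ V(C'); that is, the map C ↦ V(C) from Clar covers of G to sets of perfect matchings of G is injective. -/

import Mathlib

open SimpleGraph Polynomial

/-- A perfect matching of `G`, given as a set of edges: a set of pairwise
disjoint edges of `G` covering every vertex, i.e. every vertex of `G` lies in
exactly one edge of `M`. -/
def IsPMSet {V : Type*} (G : SimpleGraph V) (M : Set (Sym2 V)) : Prop :=
  M ⊆ G.edgeSet ∧ ∀ v : V, ∃! e, e ∈ M ∧ v ∈ e

/-- The edge set of a connected component `c` of `H`: all edges of `H` both of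
whose endpoints lie in `c`. -/
def compEdges {V : Type*} (H : SimpleGraph V) (c : H.ConnectedComponent) : Set (Sym2 V) :=
  {e | e ∈ H.edgeSet ∧ ∀ v ∈ e, v ∈ c.supp}

/-- The component `c` of `H` is a hexagon, i.e. a cycle of length six. -/
def IsHexComp {V : Type*} (H : SimpleGraph V) (c : H.ConnectedComponent) : Prop :=
  Nonempty (H.induce c.supp ≃g cycleGraph 6)

/-- The component `c` of `H` is a single edge (a copy of `K₂`). -/
def IsEdgeComp {V : Type*} (H : SimpleGraph V) (c : H.ConnectedComponent) : Prop :=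
  Nonempty (H.induce c.supp ≃g (⊤ : SimpleGraph (Fin 2)))

/-- `H` is a Clar cover of `G`: a spanning subgraph of `G` each of whose
connected components is either a 6-cycle (called a hexagon of the cover) or a
single edge. -/
def IsClarCover {V : Type*} (G H : SimpleGraph V) : Prop :=
  H ≤ G ∧ ∀ c : H.ConnectedComponent, IsHexComp H c ∨ IsEdgeComp H c

/-- For a Clar cover `H` of `G`, the set `V(C)` of perfect matchings `M` of `G`
such that every hexagon `h` of `H` is `M`-alternating (i.e. `M ∩ E(h)` is a
perfect matching of the 6-cycle `h`) and every single-edge component of `H` is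
contained in `M`. -/
def clarVC {V : Type*} (G H : SimpleGraph V) : Set {M : Set (Sym2 V) // IsPMSet G M} :=
  {M | (∀ c : H.ConnectedComponent, IsHexComp H c →
          ∀ v ∈ c.supp, ∃! e, e ∈ M.1 ∩ compEdges H c ∧ v ∈ e) ∧
       (∀ c : H.ConnectedComponent, IsEdgeComp H c → compEdges H c ⊆ M.1)}

/-- The perfect matchings of `K`, encoded as adjacency-respecting involutions, cover all
edges of `K`. -/
def MatchingCovered {W : Type*} (K : SimpleGraph W) : Prop :=
  ∀ a b, K.Adj a b → ∃ f : W → W, (∀ v, f (f v) = v ∧ K.Adj v (f v)) ∧ f a = b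

theorem matchingCovered_cycleGraph_six : MatchingCovered (cycleGraph 6) := by
  have even_succ : ∀ v : Fin 6, ∀ f : Fin 6 → Fin 6, f = ![1, 0, 3, 2, 5, 4] →
      f (f v) = v ∧ (cycleGraph 6).Adj v (f v) := by
    rintro v f rfl
    revert v
    decide
  have odd_succ : ∀ v : Fin 6, ∀ f : Fin 6 → Fin 6, f = ![5, 2, 1, 4, 3, 0] →
      f (f v) = v ∧ (cycleGraph 6).Adj v (f v) := by
    rintro v f rfl
    revert v
    decide
  have neighbors : ∀ a b : Fin 6, (cycleGraph 6).Adj a b →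
      (![1, 0, 3, 2, 5, 4] : Fin 6 → Fin 6) a = b ∨
        (![5, 2, 1, 4, 3, 0] : Fin 6 → Fin 6) a = b := by
    decide
  intro a b hab
  rcases neighbors a b hab with h | h
  · exact ⟨_, fun v => even_succ v _ rfl, h⟩
  · exact ⟨_, fun v => odd_succ v _ rfl, h⟩

theorem matchingCovered_top_fin_two : MatchingCovered (⊤ : SimpleGraph (Fin 2)) := by
  intro a b hab
  refine ⟨![1, 0], by decide, ?_⟩
  revert a b
  decide

theorem MatchingCovered.of_iso {W W' : Type*} {K : SimpleGraph W} {K' : SimpleGraph W'}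
    (h : MatchingCovered K') (φ : K ≃g K') : MatchingCovered K := by
  intro a b hab
  obtain ⟨f, hf, hfa⟩ := h (φ a) (φ b) (φ.map_rel_iff.2 hab)
  refine ⟨fun v => φ.symm (f (φ v)), fun v => ⟨by simp [(hf (φ v)).1], ?_⟩, by simp [hfa]⟩
  rw [← φ.map_rel_iff]
  simpa using (hf (φ v)).2

section

variable {V : Type*} {G H : SimpleGraph V}

theorem IsClarCover.matchingCovered_induce (hH : IsClarCover G H) (c : H.ConnectedComponent) :
    MatchingCovered (H.induce c.supp) := by
  rcases hH.2 c with ⟨⟨φ⟩⟩ | ⟨⟨φ⟩⟩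
  · exact matchingCovered_cycleGraph_six.of_iso φ
  · exact matchingCovered_top_fin_two.of_iso φ

theorem IsClarCover.exists_adj (hH : IsClarCover G H) (c : H.ConnectedComponent) :
    ∃ a b, (H.induce c.supp).Adj a b := by
  rcases hH.2 c with ⟨⟨φ⟩⟩ | ⟨⟨φ⟩⟩
  · exact ⟨φ.symm 0, φ.symm 1, φ.symm.map_rel_iff.2 (by decide)⟩
  · exact ⟨φ.symm 0, φ.symm 1, φ.symm.map_rel_iff.2 (by decide)⟩

theorem IsClarCover.matchingCovered (hH : IsClarCover G H) : MatchingCovered H := by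
  intro a b hab
  have key : ∀ c : H.ConnectedComponent, ∃ f : c.supp → c.supp,
      (∀ v, f (f v) = v ∧ (H.induce c.supp).Adj v (f v)) ∧
        ∀ ha : a ∈ c.supp, (f ⟨a, ha⟩ : V) = b := by
    intro c
    by_cases ha : a ∈ c.supp
    · have hb : b ∈ c.supp := c.mem_supp_of_adj_mem_supp ha hab
      obtain ⟨f, hf, hfa⟩ := hH.matchingCovered_induce c ⟨a, ha⟩ ⟨b, hb⟩ hab
      exact ⟨f, hf, fun _ => by rw [hfa]⟩
    · obtain ⟨x, y, hxy⟩ := hH.exists_adj c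
      obtain ⟨f, hf, -⟩ := hH.matchingCovered_induce c x y hxy
      exact ⟨f, hf, fun h => absurd h ha⟩
  choose F hF hFa using key
  have transfer : ∀ (c : H.ConnectedComponent) (v : V) (hv : v ∈ c.supp),
      (F (H.connectedComponentMk v) ⟨v, rfl⟩ : V) = F c ⟨v, hv⟩ := by
    rintro c v rfl
    rfl
  refine ⟨fun v => F (H.connectedComponentMk v) ⟨v, rfl⟩, fun v => ⟨?_, ?_⟩, hFa _ _⟩
  · dsimp only
    rw [transfer (H.connectedComponentMk v) _ (F (H.connectedComponentMk v) ⟨v, rfl⟩).2]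
    exact congrArg Subtype.val (hF _ ⟨v, rfl⟩).1
  · exact (hF (H.connectedComponentMk v) ⟨v, rfl⟩).2

theorem isPMSet_range_of_involution {f : V → V} (hf : ∀ v, f (f v) = v ∧ G.Adj v (f v)) :
    IsPMSet G (Set.range fun v => s(v, f v)) := by
  refine ⟨?_, fun v => ⟨s(v, f v), ⟨⟨v, rfl⟩, by simp⟩, ?_⟩⟩
  · rintro _ ⟨v, rfl⟩
    exact (hf v).2
  · rintro _ ⟨⟨w, rfl⟩, hv⟩
    rcases Sym2.mem_iff.1 hv with rfl | rfl
    · rfl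
    · simp [(hf w).1, Sym2.eq_swap]

theorem IsPMSet.mono {M : Set (Sym2 V)} (h : IsPMSet H M) (hHG : H ≤ G) : IsPMSet G M :=
  ⟨h.1.trans (edgeSet_mono hHG), h.2⟩

theorem IsEdgeComp.eq_of_adj {c : H.ConnectedComponent} (hc : IsEdgeComp H c) {x y z : V}
    (hx : x ∈ c.supp) (hxy : H.Adj x y) (hxz : H.Adj x z) : y = z := by
  obtain ⟨φ⟩ := hc
  have hy : y ∈ c.supp := c.mem_supp_of_adj_mem_supp hx hxy
  have hz : z ∈ c.supp := c.mem_supp_of_adj_mem_supp hx hxz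
  have h₁ : φ ⟨x, hx⟩ ≠ φ ⟨y, hy⟩ := φ.injective.ne (by simpa using hxy.ne)
  have h₂ : φ ⟨x, hx⟩ ≠ φ ⟨z, hz⟩ := φ.injective.ne (by simpa using hxz.ne)
  have h₃ : φ ⟨y, hy⟩ = φ ⟨z, hz⟩ := by omega
  simpa using φ.injective h₃

theorem mem_clarVC_of_isPMSet {M : Set (Sym2 V)} (hM : IsPMSet G M) (hMH : IsPMSet H M) :
    (⟨M, hM⟩ : {M : Set (Sym2 V) // IsPMSet G M}) ∈ clarVC G H := by
  refine ⟨fun c _ v hv => ?_, fun c hc => ?_⟩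
  · obtain ⟨e, ⟨heM, hve⟩, huniq⟩ := hMH.2 v
    refine ⟨e, ⟨⟨heM, hMH.1 heM, fun w hw => ?_⟩, hve⟩, fun e' he' => huniq e' ⟨he'.1.1, he'.2⟩⟩
    obtain ⟨u, rfl⟩ := hve
    rcases Sym2.mem_iff.1 hw with rfl | rfl
    · exact hv
    · exact c.mem_supp_of_adj_mem_supp hv (hMH.1 heM)
  · intro e
    induction e with
    | _ x y =>
      rintro ⟨hxy, hsupp⟩
      obtain ⟨e, ⟨heM, u, rfl⟩, -⟩ := hMH.2 x
      have : y = u := hc.eq_of_adj (hsupp x (by simp)) hxy (hMH.1 heM)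
      rwa [this]

theorem IsClarCover.subset_edgeSet_of_mem_clarVC (hH : IsClarCover G H)
    {M : {M : Set (Sym2 V) // IsPMSet G M}} (hM : M ∈ clarVC G H) : M.1 ⊆ H.edgeSet := by
  intro e
  induction e with
  | _ x y =>
    intro heM
    have hx : x ∈ (H.connectedComponentMk x).supp := rfl
    suffices ∃ e ∈ M.1, x ∈ e ∧ e ∈ H.edgeSet by
      obtain ⟨e, he, hxe, heH⟩ := this
      rwa [(M.2.2 x).unique ⟨heM, by simp⟩ ⟨he, hxe⟩]
    rcases hH.2 (H.connectedComponentMk x) with hc | hc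
    · obtain ⟨e, ⟨⟨he, heH, -⟩, hxe⟩, -⟩ := hM.1 _ hc x hx
      exact ⟨e, he, hxe, heH⟩
    · obtain ⟨⟨a, ha⟩, ⟨b, hb⟩, hab⟩ := hH.exists_adj (H.connectedComponentMk x)
      obtain ⟨f, hf, -⟩ := hH.matchingCovered a b hab
      refine ⟨s(x, f x), hM.2 _ hc ⟨(hf x).2, fun v hv => ?_⟩, by simp, (hf x).2⟩
      rcases Sym2.mem_iff.1 hv with rfl | rfl
      · exact hx
      · exact ConnectedComponent.mem_supp_of_adj_mem_supp _ hx (hf x).2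

theorem IsClarCover.adj_iff_exists_mem_clarVC (hH : IsClarCover G H) (a b : V) :
    H.Adj a b ↔ ∃ M ∈ clarVC G H, s(a, b) ∈ M.1 := by
  constructor
  · intro hab
    obtain ⟨f, hf, rfl⟩ := hH.matchingCovered a b hab
    have hM := isPMSet_range_of_involution hf
    exact ⟨⟨_, hM.mono hH.1⟩, mem_clarVC_of_isPMSet _ hM, a, rfl⟩
  · rintro ⟨M, hM, hab⟩
    exact hH.subset_edgeSet_of_mem_clarVC hM hab

end

/-- If `C` and `C'` are distinct Clar covers of a finite
simple graph `G`, then `V(C) ≠ V(C')`: the map `C ↦ V(C)` from Clar covers of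
`G` to sets of perfect matchings of `G` is injective. -/
theorem clarVC_injective {V : Type*} [Fintype V] (G : SimpleGraph V)
    (H H' : SimpleGraph V) (hH : IsClarCover G H) (hH' : IsClarCover G H')
    (hne : H ≠ H') :
    clarVC G H ≠ clarVC G H' := by
  intro h
  apply hne
  ext a b
  rw [hH.adj_iff_exists_mem_clarVC, hH'.adj_iff_exists_mem_clarVC, h]
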